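/- arXiv:2103.12931 — 2 statements merged into one kernel-verified Lean document; each statement's English description precedes it below -/
import Mathlib

section
/- Let (x*,λ*) be a saddle point of L, assume the scaling condition holds, and let (x,λ) be a global solution of the primal-dual dynamical system. Then there exists a constant C ≥ 0 such that ‖Ax(t) − b‖ ≤ C/√β(t) for all t ≥ t₀; in particular, if lim_{t→∞} β(t) = +∞, then ‖Ax(t) − b‖ = O(1/√β(t)) as t → ∞. -/
open scoped RealInnerProductSpace
open MeasureTheory Set

noncomputable def Lagr {n m : ℕ} (f : EuclideanSpace ℝ (Fin n) → ℝ)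
    (A : EuclideanSpace ℝ (Fin n) →L[ℝ] EuclideanSpace ℝ (Fin m))
    (b : EuclideanSpace ℝ (Fin m))
    (x : EuclideanSpace ℝ (Fin n)) (lam : EuclideanSpace ℝ (Fin m)) : ℝ :=
  f x + ⟪lam, A x - b⟫

noncomputable def AugLagr {n m : ℕ} (f : EuclideanSpace ℝ (Fin n) → ℝ)
    (A : EuclideanSpace ℝ (Fin n) →L[ℝ] EuclideanSpace ℝ (Fin m))
    (b : EuclideanSpace ℝ (Fin m)) (σ : ℝ)
    (x : EuclideanSpace ℝ (Fin n)) (lam : EuclideanSpace ℝ (Fin m)) : ℝ :=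
  Lagr f A b x lam + σ / 2 * ‖A x - b‖ ^ 2

def IsSaddlePoint {n m : ℕ} (f : EuclideanSpace ℝ (Fin n) → ℝ)
    (A : EuclideanSpace ℝ (Fin n) →L[ℝ] EuclideanSpace ℝ (Fin m))
    (b : EuclideanSpace ℝ (Fin m))
    (xs : EuclideanSpace ℝ (Fin n)) (ls : EuclideanSpace ℝ (Fin m)) : Prop :=
  ∀ x lam, Lagr f A b xs lam ≤ Lagr f A b xs ls ∧ Lagr f A b xs ls ≤ Lagr f A b x ls

/-- First-order characterization of convexity: a differentiable convex function lies above its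
tangent hyperplanes. -/
lemma ConvexOn.sub_le_inner_gradient {E : Type*} [NormedAddCommGroup E] [InnerProductSpace ℝ E]
    [CompleteSpace E] {f : E → ℝ} (hf : ConvexOn ℝ univ f) {x : E} (hd : DifferentiableAt ℝ f x)
    (y : E) : f x - f y ≤ ⟪gradient f x, x - y⟫ := by
  have hconv : ConvexOn ℝ univ (f ∘ AffineMap.lineMap (k := ℝ) y x) := hf.comp_affineMap _
  have hderiv : HasDerivAt (f ∘ AffineMap.lineMap (k := ℝ) y x) ⟪gradient f x, x - y⟫ 1 := by
    have hfx : HasFDerivAt f (InnerProductSpace.toDual ℝ E (gradient f x))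
        (AffineMap.lineMap y x (1 : ℝ)) := by
      simpa using hd.hasGradientAt.hasFDerivAt
    simpa using hfx.comp_hasDerivAt (1 : ℝ) AffineMap.hasDerivAt_lineMap
  simpa [slope_def_field] using
    hconv.slope_le_of_hasDerivAt (mem_univ 0) (mem_univ 1) zero_lt_one hderiv

/-- A saddle point is feasible. -/
lemma IsSaddlePoint.map_eq {n m : ℕ} {f : EuclideanSpace ℝ (Fin n) → ℝ}
    {A : EuclideanSpace ℝ (Fin n) →L[ℝ] EuclideanSpace ℝ (Fin m)}
    {b : EuclideanSpace ℝ (Fin m)} {xs : EuclideanSpace ℝ (Fin n)}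
    {ls : EuclideanSpace ℝ (Fin m)} (h : IsSaddlePoint f A b xs ls) : A xs = b := by
  have h1 := (h xs (ls + (A xs - b))).1
  simp only [Lagr, inner_add_left, real_inner_self_eq_norm_sq] at h1
  have h2 : ‖A xs - b‖ = 0 := by nlinarith [norm_nonneg (A xs - b)]
  exact sub_eq_zero.mp (norm_eq_zero.mp h2)

/-- The algebraic identity behind the decay of the energy along the primal-dual dynamics, where
`u = x - xs`, `v = ẋ`, `w = ẍ`, `p = ∇f(x)`, `l = λ` and `l' = λ̇`. -/
lemma energy_derivative_identity {E F : Type*} [NormedAddCommGroup E] [InnerProductSpace ℝ E]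
    [CompleteSpace E] [NormedAddCommGroup F] [InnerProductSpace ℝ F] [CompleteSpace F]
    (A : E →L[ℝ] F) {γ δ σ β : ℝ} (hδ : δ ≠ 0) (u v w p : E) (l l' ls : F)
    (hw : w + γ • v = -β • (p + A.adjoint l + σ • A.adjoint (A u)))
    (hl : l' = β • (A u + δ • A v)) :
    β * (⟪p, v⟫ + ⟪ls, A v⟫ + σ * ⟪A u, A v⟫) + ⟪δ⁻¹ • u + v, δ⁻¹ • v + w⟫
        + δ⁻¹ * ⟪l - ls, l'⟫ + (γ - δ⁻¹) * δ⁻¹ * ⟪u, v⟫ =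
      -(β / δ) * (⟪p, u⟫ + ⟪ls, A u⟫ + σ * ‖A u‖ ^ 2) - (γ - δ⁻¹) * ‖v‖ ^ 2 := by
  rw [eq_sub_of_add_eq hw, hl]
  simp only [inner_add_left, inner_add_right, inner_sub_left, inner_sub_right,
    real_inner_smul_left, real_inner_smul_right, ContinuousLinearMap.adjoint_inner_right, map_smul,
    ← real_inner_self_eq_norm_sq]
  rw [real_inner_comm v p, real_inner_comm u p, real_inner_comm l (A v), real_inner_comm l (A u),
    real_inner_comm (A u) (A v)]
  field_simp
  ring

theorem feasibility_rate
    {n m : ℕ}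
    (f : EuclideanSpace ℝ (Fin n) → ℝ)
    (hf_conv : ConvexOn ℝ Set.univ f)
    (hf_smooth : ContDiff ℝ 1 f)
    (A : EuclideanSpace ℝ (Fin n) →L[ℝ] EuclideanSpace ℝ (Fin m))
    (b : EuclideanSpace ℝ (Fin m))
    (t₀ γ δ σ : ℝ) (ht₀ : 0 ≤ t₀) (hγ : 0 < γ) (hδ : 0 < δ) (hσ : 0 < σ)
    (β β' : ℝ → ℝ)
    (hβpos : ∀ t ∈ Ici t₀, 0 < β t)
    (hβderiv : ∀ t ∈ Ici t₀, HasDerivWithinAt β (β' t) (Ici t₀) t)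
    (hβ'cont : ContinuousOn β' (Ici t₀))
    (xs : EuclideanSpace ℝ (Fin n)) (ls : EuclideanSpace ℝ (Fin m))
    (hsaddle : IsSaddlePoint f A b xs ls)
    (hscale : ∀ t ∈ Ici t₀, β' t ≤ β t / δ) (hscale' : 1 / δ < γ)
    (x x' x'' : ℝ → EuclideanSpace ℝ (Fin n))
    (lam lam' : ℝ → EuclideanSpace ℝ (Fin m))
    (hx : ∀ t ∈ Ici t₀, HasDerivWithinAt x (x' t) (Ici t₀) t)
    (hx' : ∀ t ∈ Ici t₀, HasDerivWithinAt x' (x'' t) (Ici t₀) t)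
    (hx''cont : ContinuousOn x'' (Ici t₀))
    (hlam : ∀ t ∈ Ici t₀, HasDerivWithinAt lam (lam' t) (Ici t₀) t)
    (hlam'cont : ContinuousOn lam' (Ici t₀))
    (hode1 : ∀ t ∈ Ici t₀, x'' t + γ • x' t =
      -(β t) • (gradient f (x t) + A.adjoint (lam t) + σ • A.adjoint (A (x t) - b)))
    (hode2 : ∀ t ∈ Ici t₀, lam' t = β t • (A (x t + δ • x' t) - b))
    :
    ∃ C : ℝ, 0 ≤ C ∧ ∀ t ∈ Ici t₀,
      ‖A (x t) - b‖ ≤ C / Real.sqrt (β t) := by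
  have hfeas := hsaddle.map_eq
  have hA : ∀ t, A (x t - xs) = A (x t) - b := fun t => by rw [map_sub, hfeas]
  have hdiff : Differentiable ℝ f := hf_smooth.differentiable one_ne_zero
  have hgap : ∀ y, 0 ≤ f y - f xs + ⟪ls, A y - b⟫ := fun y => by
    have := (hsaddle y ls).2
    simp only [Lagr, hfeas, sub_self, inner_zero_right] at this
    linarith
  have hγδ : 0 < γ - δ⁻¹ := by rw [one_div] at hscale'; linarith
  let Φ : ℝ → ℝ := fun t => f (x t) - f xs + ⟪ls, A (x t) - b⟫ + σ / 2 * ‖A (x t) - b‖ ^ 2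
  let V : ℝ → ℝ := fun t => β t * Φ t + 1 / 2 * ‖δ⁻¹ • (x t - xs) + x' t‖ ^ 2
    + δ⁻¹ / 2 * ‖lam t - ls‖ ^ 2 + (γ - δ⁻¹) * δ⁻¹ / 2 * ‖x t - xs‖ ^ 2
  let V' : ℝ → ℝ := fun t => β' t * Φ t
    + β t * (⟪gradient f (x t), x' t⟫ + ⟪ls, A (x' t)⟫ + σ * ⟪A (x t - xs), A (x' t)⟫)
    + ⟪δ⁻¹ • (x t - xs) + x' t, δ⁻¹ • x' t + x'' t⟫
    + δ⁻¹ * ⟪lam t - ls, lam' t⟫ + (γ - δ⁻¹) * δ⁻¹ * ⟪x t - xs, x' t⟫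
  have hV : ∀ t ∈ Ici t₀, HasDerivWithinAt V (V' t) (Ici t₀) t := fun t ht => by
    have hu := (hx t ht).sub_const xs
    have hg : HasDerivWithinAt (fun t => A (x t) - b) (A (x' t)) (Ici t₀) t :=
      (A.hasFDerivAt.comp_hasDerivWithinAt t (hx t ht)).sub_const b
    have hfx : HasDerivWithinAt (fun t => f (x t)) ⟪gradient f (x t), x' t⟫ (Ici t₀) t :=
      (hdiff (x t)).hasGradientAt.hasFDerivAt.comp_hasDerivWithinAt t (hx t ht)
    have hlg := (hasDerivWithinAt_const t (Ici t₀) ls).inner ℝ hg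
    have hΦ := ((hfx.sub_const (f xs)).add hlg).add (hg.norm_sq.const_mul (σ / 2))
    have hv := ((hu.const_smul δ⁻¹).add (hx' t ht)).norm_sq.const_mul (1 / 2 : ℝ)
    have hl := ((hlam t ht).sub_const ls).norm_sq.const_mul (δ⁻¹ / 2)
    refine (((((hβderiv t ht).mul hΦ).add hv).add hl).add
      (hu.norm_sq.const_mul ((γ - δ⁻¹) * δ⁻¹ / 2))).congr_deriv ?_
    simp only [V', Φ, hA, inner_zero_left, Pi.add_apply, Pi.smul_apply]
    ring
  have hV' : ∀ t ∈ Ici t₀, V' t ≤ 0 := fun t ht => by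
    have hid := energy_derivative_identity (β := β t) A hδ.ne' (x t - xs) (x' t) (x'' t)
      (gradient f (x t)) (lam t) (lam' t) ls (by rw [hA]; exact hode1 t ht)
      (by rw [hode2 t ht, map_add, map_smul, hA, add_sub_right_comm])
    have hconv := hf_conv.sub_le_inner_gradient (hdiff (x t)) xs
    have hΦ0 : 0 ≤ Φ t := add_nonneg (hgap _) (by positivity)
    have h1 : β' t * Φ t ≤ β t / δ * Φ t := mul_le_mul_of_nonneg_right (hscale t ht) hΦ0
    have h2 : β t / δ * Φ t ≤ β t / δ * (⟪gradient f (x t), x t - xs⟫ + ⟪ls, A (x t - xs)⟫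
        + σ * ‖A (x t - xs)‖ ^ 2) := by
      refine mul_le_mul_of_nonneg_left ?_ (div_pos (hβpos t ht) hδ).le
      simp only [Φ, hA]
      nlinarith [mul_nonneg hσ.le (sq_nonneg ‖A (x t) - b‖)]
    have h3 : 0 ≤ (γ - δ⁻¹) * ‖x' t‖ ^ 2 := by positivity
    simp only [V']
    linarith
  have hanti : AntitoneOn V (Ici t₀) :=
    antitoneOn_of_hasDerivWithinAt_nonpos (convex_Ici t₀)
      (fun t ht => (hV t ht).continuousWithinAt)
      (fun t ht => (hV t (interior_subset ht)).mono interior_subset)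
      (fun t ht => hV' t (interior_subset ht))
  refine ⟨√(2 * V t₀ / σ), Real.sqrt_nonneg _, fun t ht => ?_⟩
  have hβt := hβpos t ht
  rw [le_div_iff₀ (Real.sqrt_pos.mpr hβt)]
  refine Real.le_sqrt_of_sq_le ?_
  rw [mul_pow, Real.sq_sqrt hβt.le, le_div_iff₀ hσ]
  have h1 : V t ≤ V t₀ := hanti self_mem_Ici ht ht
  have h2 : β t * (σ / 2 * ‖A (x t) - b‖ ^ 2) ≤ β t * Φ t :=
    mul_le_mul_of_nonneg_left (le_add_of_nonneg_left (hgap _)) hβt.le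
  have h3 : β t * Φ t ≤ V t := by
    have h4 : 0 ≤ 1 / 2 * ‖δ⁻¹ • (x t - xs) + x' t‖ ^ 2 := by positivity
    have h5 : 0 ≤ δ⁻¹ / 2 * ‖lam t - ls‖ ^ 2 := by positivity
    have h6 : 0 ≤ (γ - δ⁻¹) * δ⁻¹ / 2 * ‖x t - xs‖ ^ 2 := by positivity
    simp only [V]
    linarith
  linarith
end

section
/- Let (x*,λ*) be a saddle point of L, assume β(t) ≡ β > 0 is constant and γδ > 1, and let (x,λ) be a global solution of the primal-dual dynamical system. Define the ergodic average x̄(t) = (1/(t − t₀)) ∫_{t₀}^{t} x(s) ds for t > t₀. Then ‖Ax̄(t) − b‖ = O(1/t) as t → ∞, i.e., there exist C ≥ 0 and T > t₀ such that ‖Ax̄(t) − b‖ ≤ C/t for all t ≥ T. -/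
open scoped RealInnerProductSpace
open MeasureTheory Set

/-- A differentiable convex function lies above its tangent hyperplanes. -/
theorem ConvexOn.add_inner_gradient_le {E : Type*} [NormedAddCommGroup E] [InnerProductSpace ℝ E]
    [CompleteSpace E] {f : E → ℝ} (hf : ConvexOn ℝ univ f) {x : E} (hfx : DifferentiableAt ℝ f x)
    (y : E) : f x + ⟪gradient f x, y - x⟫ ≤ f y := by
  have hline : ConvexOn ℝ univ (f ∘ AffineMap.lineMap (k := ℝ) x y) := by
    simpa using hf.comp_affineMap (AffineMap.lineMap (k := ℝ) x y)
  have hderiv : HasDerivAt (f ∘ AffineMap.lineMap (k := ℝ) x y) ⟪gradient f x, y - x⟫ 0 := by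
    have h : HasFDerivAt f (InnerProductSpace.toDual ℝ E (gradient f x))
        (AffineMap.lineMap (k := ℝ) x y (0 : ℝ)) := by
      simpa using hfx.hasGradientAt.hasFDerivAt
    simpa using h.comp_hasDerivAt (0 : ℝ) AffineMap.hasDerivAt_lineMap
  have hslope := hline.le_slope_of_hasDerivAt (mem_univ 0) (mem_univ 1) one_pos hderiv
  simp only [slope_def_field, Function.comp_apply, AffineMap.lineMap_apply_zero,
    AffineMap.lineMap_apply_one, sub_zero, div_one] at hslope
  linarith

namespace IsSaddlePoint

variable {n m : ℕ} {f : EuclideanSpace ℝ (Fin n) → ℝ}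
  {A : EuclideanSpace ℝ (Fin n) →L[ℝ] EuclideanSpace ℝ (Fin m)} {b : EuclideanSpace ℝ (Fin m)}
  {xs : EuclideanSpace ℝ (Fin n)} {ls : EuclideanSpace ℝ (Fin m)}

theorem map_eq_s11 (h : IsSaddlePoint f A b xs ls) : A xs = b := by
  have h1 := (h xs (ls + (A xs - b))).1
  simp only [Lagr, inner_add_left, real_inner_self_eq_norm_sq] at h1
  have h2 : ‖A xs - b‖ ^ 2 = 0 := le_antisymm (by linarith) (sq_nonneg _)
  simpa [sub_eq_zero] using h2

theorem le_add_inner (h : IsSaddlePoint f A b xs ls) (x : EuclideanSpace ℝ (Fin n)) :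
    f xs ≤ f x + ⟪ls, A x - b⟫ := by
  simpa [Lagr, h.map_eq_s11] using (h x ls).2

end IsSaddlePoint

/-- The Lyapunov function of the primal-dual dynamical system, as a function of position `x`,
velocity `v` and multiplier `lam`. -/
noncomputable def primalDualEnergy {n m : ℕ} (f : EuclideanSpace ℝ (Fin n) → ℝ)
    (A : EuclideanSpace ℝ (Fin n) →L[ℝ] EuclideanSpace ℝ (Fin m))
    (b : EuclideanSpace ℝ (Fin m)) (γ δ σ β : ℝ)
    (xs : EuclideanSpace ℝ (Fin n)) (ls : EuclideanSpace ℝ (Fin m))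
    (x v : EuclideanSpace ℝ (Fin n)) (lam : EuclideanSpace ℝ (Fin m)) : ℝ :=
  1 / 2 * ‖x - xs + δ • v‖ ^ 2 + (γ * δ - 1) / 2 * ‖x - xs‖ ^ 2 + δ / 2 * ‖lam - ls‖ ^ 2 +
    δ ^ 2 * β * (f x - f xs + ⟪ls, A x - b⟫ + σ / 2 * ‖A x - b‖ ^ 2)

section Energy

variable {n m : ℕ} {f : EuclideanSpace ℝ (Fin n) → ℝ}
  {A : EuclideanSpace ℝ (Fin n) →L[ℝ] EuclideanSpace ℝ (Fin m)} {b : EuclideanSpace ℝ (Fin m)}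
  {γ δ σ β : ℝ} {xs : EuclideanSpace ℝ (Fin n)} {ls : EuclideanSpace ℝ (Fin m)}

theorem primalDualEnergy_lower_bound (hδ : 0 < δ) (hσ : 0 < σ) (hβ : 0 < β)
    (hsaddle : IsSaddlePoint f A b xs ls)
    (x v : EuclideanSpace ℝ (Fin n)) (lam : EuclideanSpace ℝ (Fin m)) :
    (γ * δ - 1) / 2 * ‖x - xs‖ ^ 2 + δ / 2 * ‖lam - ls‖ ^ 2 ≤
      primalDualEnergy f A b γ δ σ β xs ls x v lam := by
  have h1 : 0 ≤ f x - f xs + ⟪ls, A x - b⟫ := by linarith [hsaddle.le_add_inner x]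
  have h2 : 0 ≤ δ ^ 2 * β * (f x - f xs + ⟪ls, A x - b⟫ + σ / 2 * ‖A x - b‖ ^ 2) := by
    positivity
  have h3 : 0 ≤ 1 / 2 * ‖x - xs + δ • v‖ ^ 2 := by positivity
  unfold primalDualEnergy
  linarith

/-- Along the dynamics, the energy dissipates at the stated rate. -/
theorem hasDerivWithinAt_primalDualEnergy (hf : Differentiable ℝ f) (hb : A xs = b)
    {x x' : ℝ → EuclideanSpace ℝ (Fin n)} {x'' : EuclideanSpace ℝ (Fin n)}
    {lam : ℝ → EuclideanSpace ℝ (Fin m)} {lam' : EuclideanSpace ℝ (Fin m)} {s : Set ℝ} {t : ℝ}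
    (hx : HasDerivWithinAt x (x' t) s t) (hx' : HasDerivWithinAt x' x'' s t)
    (hlam : HasDerivWithinAt lam lam' s t)
    (hode1 : x'' + γ • x' t =
      -β • (gradient f (x t) + A.adjoint (lam t) + σ • A.adjoint (A (x t) - b)))
    (hode2 : lam' = β • (A (x t + δ • x' t) - b)) :
    HasDerivWithinAt (fun t => primalDualEnergy f A b γ δ σ β xs ls (x t) (x' t) (lam t))
      (-(δ * (γ * δ - 1) * ‖x' t‖ ^ 2 + δ * β *
        (⟪gradient f (x t), x t - xs⟫ + ⟪ls, A (x t) - b⟫ + σ * ‖A (x t) - b‖ ^ 2))) s t := by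
  have hAx : HasDerivWithinAt (fun t => A (x t) - b) (A (x' t)) s t :=
    (A.hasFDerivAt.comp_hasDerivWithinAt t hx).sub_const b
  have hfx : HasDerivWithinAt (fun t => f (x t)) ⟪gradient f (x t), x' t⟫ s t :=
    (hf (x t)).hasGradientAt.hasFDerivAt.comp_hasDerivWithinAt t hx
  have hz := hx.sub_const xs
  have hinner : HasDerivWithinAt (fun t => ⟪ls, A (x t) - b⟫) ⟪ls, A (x' t)⟫ s t := by
    simpa using (hasDerivWithinAt_const t s ls).inner ℝ hAx
  have hE := (((((hz.add (hx'.const_smul δ)).norm_sq).const_mul (1 / 2)).add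
    (hz.norm_sq.const_mul ((γ * δ - 1) / 2))).add
    ((hlam.sub_const ls).norm_sq.const_mul (δ / 2))).add
    ((((hfx.sub_const (f xs)).add hinner).add
      (hAx.norm_sq.const_mul (σ / 2))).const_mul (δ ^ 2 * β))
  refine hE.congr_deriv ?_
  obtain rfl := eq_sub_of_add_eq hode1
  subst hode2 hb
  simp only [Pi.add_apply, Pi.smul_apply, ← map_sub, ← real_inner_self_eq_norm_sq, map_add, map_smul,
    inner_add_left, inner_add_right, inner_sub_left, inner_sub_right, inner_smul_left,
    inner_smul_right, smul_add, smul_sub, ContinuousLinearMap.adjoint_inner_right,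
    add_sub_right_comm, conj_trivial]
  rw [real_inner_comm (lam t), real_inner_comm (lam t), real_inner_comm (A (x t - xs)) (A (x' t)),
    real_inner_comm (x t), real_inner_comm xs, real_inner_comm (x' t) (gradient f (x t))]
  ring

theorem antitoneOn_primalDualEnergy (hf_conv : ConvexOn ℝ univ f) (hf : Differentiable ℝ f)
    (hδ : 0 < δ) (hσ : 0 < σ) (hβ : 0 < β) (hγδ : 1 < γ * δ)
    (hsaddle : IsSaddlePoint f A b xs ls) {t₀ : ℝ}
    {x x' x'' : ℝ → EuclideanSpace ℝ (Fin n)} {lam lam' : ℝ → EuclideanSpace ℝ (Fin m)}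
    (hx : ∀ t ∈ Ici t₀, HasDerivWithinAt x (x' t) (Ici t₀) t)
    (hx' : ∀ t ∈ Ici t₀, HasDerivWithinAt x' (x'' t) (Ici t₀) t)
    (hlam : ∀ t ∈ Ici t₀, HasDerivWithinAt lam (lam' t) (Ici t₀) t)
    (hode1 : ∀ t ∈ Ici t₀, x'' t + γ • x' t =
      -β • (gradient f (x t) + A.adjoint (lam t) + σ • A.adjoint (A (x t) - b)))
    (hode2 : ∀ t ∈ Ici t₀, lam' t = β • (A (x t + δ • x' t) - b)) :
    AntitoneOn (fun t => primalDualEnergy f A b γ δ σ β xs ls (x t) (x' t) (lam t))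
      (Ici t₀) := by
  have hE (t : ℝ) (ht : t ∈ Ici t₀) := hasDerivWithinAt_primalDualEnergy hf hsaddle.map_eq_s11
    (hx t ht) (hx' t ht) (hlam t ht) (hode1 t ht) (hode2 t ht) (ls := ls)
  refine antitoneOn_of_hasDerivWithinAt_nonpos (convex_Ici t₀)
    (fun t ht => (hE t ht).continuousWithinAt)
    (fun t ht => (hE t (interior_subset ht)).mono interior_subset) fun t _ => ?_
  have hgrad := hf_conv.add_inner_gradient_le (hf (x t)) xs
  rw [← neg_sub (x t) xs, inner_neg_right] at hgrad
  have h1 : 0 ≤ ⟪gradient f (x t), x t - xs⟫ + ⟪ls, A (x t) - b⟫ := by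
    linarith [hsaddle.le_add_inner (x t)]
  have h2 : 0 < γ * δ - 1 := by linarith
  exact neg_nonpos.2 (by positivity)

end Energy

/-- The dual equation integrates to express the time integral of the constraint violation. -/
theorem integral_constraint_violation {n m : ℕ}
    {A : EuclideanSpace ℝ (Fin n) →L[ℝ] EuclideanSpace ℝ (Fin m)} {b : EuclideanSpace ℝ (Fin m)}
    {δ β t₀ : ℝ} {x x' : ℝ → EuclideanSpace ℝ (Fin n)}
    {lam lam' : ℝ → EuclideanSpace ℝ (Fin m)}
    (hx : ∀ t ∈ Ici t₀, HasDerivWithinAt x (x' t) (Ici t₀) t)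
    (hlam : ∀ t ∈ Ici t₀, HasDerivWithinAt lam (lam' t) (Ici t₀) t)
    (hode2 : ∀ t ∈ Ici t₀, lam' t = β • (A (x t + δ • x' t) - b)) {t : ℝ} (ht : t₀ ≤ t) :
    β • (A (∫ s in t₀..t, x s) - (t - t₀) • b) =
      lam t - lam t₀ - (β * δ) • A (x t - x t₀) := by
  have hxcont : ContinuousOn x (Icc t₀ t) := fun s hs =>
    (hx s hs.1).continuousWithinAt.mono Icc_subset_Ici_self
  have hderiv (s : ℝ) (hs : s ∈ Ici t₀) :
      HasDerivWithinAt (fun s => lam s - (β * δ) • A (x s)) (β • (A (x s) - b)) (Ici t₀) s := by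
    refine ((hlam s hs).sub ((A.hasFDerivAt.comp_hasDerivWithinAt s (hx s hs)).const_smul
      (β * δ))).congr_deriv ?_
    rw [hode2 s hs, map_add, map_smul]
    module
  have hint : IntervalIntegrable x volume t₀ t := hxcont.intervalIntegrable_of_Icc ht
  have hintA : IntervalIntegrable (fun s => A (x s)) volume t₀ t :=
    (A.continuous.comp_continuousOn hxcont).intervalIntegrable_of_Icc ht
  have hftc := intervalIntegral.integral_eq_sub_of_hasDeriv_right_of_le ht
    (fun s hs => (hderiv s hs.1).continuousWithinAt.mono Icc_subset_Ici_self)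
    (fun s hs => (hderiv s hs.1.le).mono fun r hr => hs.1.le.trans (le_of_lt hr))
    ((hintA.sub intervalIntegrable_const).smul β)
  rw [intervalIntegral.integral_smul, intervalIntegral.integral_sub hintA intervalIntegrable_const,
    A.intervalIntegral_comp_comm hint, intervalIntegral.integral_const] at hftc
  rw [hftc, map_sub, smul_sub]
  abel

theorem ergodic_feasibility_rate
    {n m : ℕ}
    (f : EuclideanSpace ℝ (Fin n) → ℝ)
    (hf_conv : ConvexOn ℝ Set.univ f)
    (hf_smooth : ContDiff ℝ 1 f)
    (A : EuclideanSpace ℝ (Fin n) →L[ℝ] EuclideanSpace ℝ (Fin m))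
    (b : EuclideanSpace ℝ (Fin m))
    (t₀ γ δ σ : ℝ) (ht₀ : 0 ≤ t₀) (hγ : 0 < γ) (hδ : 0 < δ) (hσ : 0 < σ)
    (β : ℝ) (hβpos : 0 < β) (hγδ : 1 < γ * δ)
    (xs : EuclideanSpace ℝ (Fin n)) (ls : EuclideanSpace ℝ (Fin m))
    (hsaddle : IsSaddlePoint f A b xs ls)
    (x x' x'' : ℝ → EuclideanSpace ℝ (Fin n))
    (lam lam' : ℝ → EuclideanSpace ℝ (Fin m))
    (hx : ∀ t ∈ Ici t₀, HasDerivWithinAt x (x' t) (Ici t₀) t)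
    (hx' : ∀ t ∈ Ici t₀, HasDerivWithinAt x' (x'' t) (Ici t₀) t)
    (hx''cont : ContinuousOn x'' (Ici t₀))
    (hlam : ∀ t ∈ Ici t₀, HasDerivWithinAt lam (lam' t) (Ici t₀) t)
    (hlam'cont : ContinuousOn lam' (Ici t₀))
    (hode1 : ∀ t ∈ Ici t₀, x'' t + γ • x' t =
      -β • (gradient f (x t) + A.adjoint (lam t) + σ • A.adjoint (A (x t) - b)))
    (hode2 : ∀ t ∈ Ici t₀, lam' t = β • (A (x t + δ • x' t) - b))
    (xbar : ℝ → EuclideanSpace ℝ (Fin n))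
    (hxbar : ∀ t, t₀ < t → xbar t = (1 / (t - t₀)) • ∫ s in t₀..t, x s)
    :
    ∃ C T : ℝ, 0 ≤ C ∧ t₀ < T ∧ ∀ t ≥ T, ‖A (xbar t) - b‖ ≤ C / t := by
  have hf : Differentiable ℝ f := hf_smooth.differentiable one_ne_zero
  set E : ℝ → ℝ := fun t => primalDualEnergy f A b γ δ σ β xs ls (x t) (x' t) (lam t)
  have hanti : AntitoneOn E (Ici t₀) := antitoneOn_primalDualEnergy hf_conv hf hδ hσ hβpos hγδ
    hsaddle hx hx' hlam hode1 hode2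
  have hbound (t : ℝ) (ht : t₀ ≤ t) :
      (γ * δ - 1) / 2 * ‖x t - xs‖ ^ 2 + δ / 2 * ‖lam t - ls‖ ^ 2 ≤ E t₀ :=
    (primalDualEnergy_lower_bound hδ hσ hβpos hsaddle _ _ _).trans
      (hanti self_mem_Ici ht ht)
  have hγδ' : 0 < γ * δ - 1 := by linarith
  set R := √(E t₀ / ((γ * δ - 1) / 2))
  set S := √(E t₀ / (δ / 2))
  have hxR (t : ℝ) (ht : t₀ ≤ t) : ‖x t - xs‖ ≤ R := by
    refine Real.le_sqrt_of_sq_le ?_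
    rw [le_div_iff₀' (by positivity)]
    have : 0 ≤ δ / 2 * ‖lam t - ls‖ ^ 2 := by positivity
    linarith [hbound t ht]
  have hlamS (t : ℝ) (ht : t₀ ≤ t) : ‖lam t - ls‖ ≤ S := by
    refine Real.le_sqrt_of_sq_le ?_
    rw [le_div_iff₀' (by positivity)]
    have : 0 ≤ (γ * δ - 1) / 2 * ‖x t - xs‖ ^ 2 := by positivity
    linarith [hbound t ht]
  set K := (2 * S + β * δ * (‖A‖ * (2 * R))) / β with hK
  have hK0 : 0 ≤ K := by positivity
  refine ⟨2 * K, 2 * t₀ + 1, by positivity, by linarith, fun t ht => ?_⟩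
  have htt : 0 < t - t₀ := by linarith
  have hint : ‖A (∫ s in t₀..t, x s) - (t - t₀) • b‖ ≤ K := by
    rw [hK, le_div_iff₀' hβpos]
    calc β * ‖A (∫ s in t₀..t, x s) - (t - t₀) • b‖
        = ‖lam t - lam t₀ - (β * δ) • A (x t - x t₀)‖ := by
          rw [← integral_constraint_violation hx hlam hode2 (by linarith), norm_smul,
            Real.norm_of_nonneg hβpos.le]
      _ ≤ ‖lam t - lam t₀‖ + β * δ * (‖A‖ * ‖x t - x t₀‖) := by
          refine (norm_sub_le _ _).trans ?_
          rw [norm_smul, Real.norm_of_nonneg (by positivity)]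
          gcongr
          exact A.le_opNorm _
      _ ≤ 2 * S + β * δ * (‖A‖ * (2 * R)) := by
          have h1 : ‖lam t - lam t₀‖ ≤ 2 * S := by
            have := norm_sub_le_norm_sub_add_norm_sub (lam t) ls (lam t₀)
            linarith [hlamS t (by linarith), hlamS t₀ le_rfl, norm_sub_rev ls (lam t₀)]
          have h2 : ‖x t - x t₀‖ ≤ 2 * R := by
            have := norm_sub_le_norm_sub_add_norm_sub (x t) xs (x t₀)
            linarith [hxR t (by linarith), hxR t₀ le_rfl, norm_sub_rev xs (x t₀)]
          gcongr
  have hmean : A (xbar t) - b = (t - t₀)⁻¹ • (A (∫ s in t₀..t, x s) - (t - t₀) • b) := by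
    rw [hxbar t (by linarith), one_div, map_smul, smul_sub, inv_smul_smul₀ htt.ne']
  rw [hmean, norm_smul, Real.norm_of_nonneg (inv_nonneg.2 htt.le), inv_mul_eq_div,
    div_le_div_iff₀ htt (by linarith)]
  calc _ ≤ K * t := by gcongr; linarith
    _ ≤ 2 * K * (t - t₀) := by nlinarith
end
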